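/- arXiv:1507.04330 — 2 statements merged into one kernel-verified Lean document; each statement's English description precedes it below -/
import Mathlib

section
/- Let G_old=(V,E_old) and G_new=(V,E_new) be finite simple graphs on the same vertex set that differ in exactly one edge (E_new = E_old ∪ {{a,b}} or E_new = E_old ∖ {{a,b}}). Then the expectation, over a uniformly random linear order π on V, of the size of the influenced set satisfies E_π[|S(G_old,G_new,π)|] ≤ 1. -/
open scoped Classical

noncomputable section

variable {V : Type*}

/-- The MIS invariant: `v ∈ M` iff no earlier neighbor of `v` is in `M`. -/
def misInv (G : SimpleGraph V) (π : V → ℕ) (M : Set V) : Prop :=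
  ∀ v, v ∈ M ↔ ∀ u, G.Adj u v → π u < π v → u ∉ M

/-- Membership in the greedy MIS of `G` under the order `π`. -/
def greedy (G : SimpleGraph V) (π : V → ℕ) (v : V) : Prop :=
  ∀ u, G.Adj u v → ∀ _hlt : π u < π v, ¬ greedy G π u
termination_by π v

/-- The greedy MIS of `G` under the order `π`. -/
def greedySet (G : SimpleGraph V) (π : V → ℕ) : Set V := {v | greedy G π v}

/-- The MIS invariant holds at vertex `v` for states `M`. -/
def invAt (G : SimpleGraph V) (M : Set V) (π : V → ℕ) (v : V) : Prop :=
  v ∈ M ↔ ∀ u, G.Adj u v → π u < π v → u ∉ M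

/-- `I_π(u)`: neighbors of `u` preceding `u` in `π`. -/
def Iset (G : SimpleGraph V) (π : V → ℕ) (u : V) : Set V :=
  {w | G.Adj w u ∧ π w < π u}

/-- The layers `S_i` of the influenced set. -/
def Slayer (H : SimpleGraph V) (M : Set V) (π : V → ℕ) (v0 : V) : ℕ → Set V
  | 0 => {v0}
  | i + 1 =>
      {u | u ∈ M ∧ ∃ w ∈ Slayer H M π v0 i, w ∈ Iset H π u} ∪
      {u | u ∉ M ∧ ∀ w ∈ Iset H π u, w ∈ M → ∃ j, ∃ _hj : j ≤ i, w ∈ Slayer H M π v0 j}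
decreasing_by all_goals omega

/-- The union of all layers. -/
def Sunion (H : SimpleGraph V) (M : Set V) (π : V → ℕ) (v0 : V) : Set V :=
  ⋃ i, Slayer H M π v0 i

/-- The influenced set: empty when the invariant is not `broken` at `v0`. -/
def Sinfl (H : SimpleGraph V) (M : Set V) (π : V → ℕ) (v0 : V) (broken : Prop) : Set V :=
  if broken then Sunion H M π v0 else ∅

/-- The order obtained from `π` by moving `v0` to be first. -/
def pushFirst (π : V → ℕ) (v0 : V) : V → ℕ :=
  fun v => if v = v0 then 0 else π v + 1

/-- The ℕ-valued order attached to a uniformly random bijection `V ≃ Fin |V|`. -/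
def toOrd [Fintype V] (π : V ≃ Fin (Fintype.card V)) : V → ℕ := fun v => (π v : ℕ)

/-- `π` and `σ` induce the same relative order on `A`. -/
def sameOrderOn (π σ : V → ℕ) (A : Set V) : Prop :=
  ∀ x ∈ A, ∀ y ∈ A, (π x < π y ↔ σ x < σ y)

/-- `P` is the set of vertices influenced by the vertex `b`, relative to the states `M`, where `M`
obeys the MIS invariant of `H` away from `b` and the state of `b` is prescribed by `β`. -/
structure IsInfluence (H : SimpleGraph V) (b : V) (β : Prop) (π : V → ℕ) (M P : Set V) :
    Prop where
  source_mem : b ∈ P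
  source_state : b ∈ M ↔ β
  mem_state_iff : ∀ u, u ≠ b → (u ∈ M ↔ ∀ w, H.Adj w u → π w < π u → w ∉ M)
  mem_iff : ∀ u, u ≠ b → (u ∈ P ↔ (u ∈ M ∧ ∃ w ∈ P, H.Adj w u ∧ π w < π u) ∨
    (u ∉ M ∧ ∀ w, H.Adj w u → π w < π u → w ∈ M → w ∈ P))

namespace IsInfluence

variable {H : SimpleGraph V} {b : V} {β : Prop} {π τ : V → ℕ} {M M' P P' : Set V}

theorem state_unique (h : IsInfluence H b β π M P) (h' : IsInfluence H b β π M' P') :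
    M = M' := by
  suffices ∀ n u, π u = n → (u ∈ M ↔ u ∈ M') from Set.ext fun u => this _ u rfl
  intro n
  induction n using Nat.strong_induction_on with
  | _ n ih =>
    rintro u rfl
    by_cases hu : u = b
    · rw [hu, h.source_state, h'.source_state]
    · rw [h.mem_state_iff u hu, h'.mem_state_iff u hu]
      exact forall_congr' fun w => imp_congr_right fun _ => imp_congr_right fun hw =>
        not_congr (ih _ hw w rfl)

theorem unique (h : IsInfluence H b β π M P) (h' : IsInfluence H b β π M' P') : P = P' := by
  obtain rfl := h.state_unique h'
  suffices ∀ n u, π u = n → (u ∈ P ↔ u ∈ P') from Set.ext fun u => this _ u rfl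
  intro n
  induction n using Nat.strong_induction_on with
  | _ n ih =>
    rintro u rfl
    by_cases hu : u = b
    · rw [hu]
      exact iff_of_true h.source_mem h'.source_mem
    · rw [h.mem_iff u hu, h'.mem_iff u hu]
      have key : ∀ w, π w < π u → (w ∈ P ↔ w ∈ P') := fun w hw => ih _ hw w rfl
      grind

theorem source_le (h : IsInfluence H b β π M P) {u : V} (hu : u ∈ P) : π b ≤ π u := by
  suffices ∀ n u, π u = n → u ∈ P → π b ≤ π u from this _ u rfl hu
  intro n
  induction n using Nat.strong_induction_on with
  | _ n ih =>
    rintro u rfl hu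
    by_cases hub : u = b
    · rw [hub]
    · obtain ⟨-, w, hwP, -, hw⟩ | ⟨huM, hall⟩ := (h.mem_iff u hub).1 hu
      · exact (ih _ hw w rfl hwP).trans hw.le
      · rw [h.mem_state_iff u hub] at huM
        push Not at huM
        obtain ⟨w, hadj, hw, hwM⟩ := huM
        exact (ih _ hw w rfl (hall w hadj hw hwM)).trans hw.le

theorem not_adj (h : IsInfluence H b β π M P) (hπ : Function.Injective π)
    (hb : ∀ w, H.Adj w b → π w < π b → w ∉ M) {u w : V} (huM : u ∈ M) (huP : u ∉ P)
    (hwP : w ∈ P) : ¬ H.Adj u w := by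
  intro hadj
  have hub : u ≠ b := fun e => huP (e ▸ h.source_mem)
  rcases lt_or_gt_of_ne (hπ.ne hadj.ne) with hlt | hgt
  · by_cases hwb : w = b
    · subst hwb
      exact hb u hadj hlt huM
    · obtain ⟨hwM, -⟩ | ⟨-, hall⟩ := (h.mem_iff w hwb).1 hwP
      · exact (h.mem_state_iff w hwb).1 hwM u hadj hlt huM
      · exact huP (hall u hadj hlt huM)
  · exact huP ((h.mem_iff u hub).2 (Or.inl ⟨huM, w, hwP, hadj.symm, hgt⟩))

/-- The influenced set only depends on the relative orders on `P` and on its complement. -/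
theorem transfer (h : IsInfluence H b β π M P) (hπ : Function.Injective π)
    (hb : ∀ w, H.Adj w b → π w < π b → w ∉ M) (hP : sameOrderOn π τ P)
    (hPc : sameOrderOn π τ Pᶜ) : IsInfluence H b β τ M P := by
  have hN : ∀ u w, u ∈ M → u ∉ P → w ∈ P → ¬ H.Adj u w := fun u w h₁ h₂ h₃ =>
    h.not_adj hπ hb h₁ h₂ h₃
  have hdom : ∀ u, u ∉ M → u ∉ P → ∃ w, H.Adj w u ∧ π w < π u ∧ w ∈ M ∧ w ∉ P := by
    intro u huM huP
    have hub : u ≠ b := fun e => huP (e ▸ h.source_mem)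
    by_contra hcon
    push Not at hcon
    exact huP ((h.mem_iff u hub).2 (Or.inr ⟨huM, hcon⟩))
  refine ⟨h.source_mem, h.source_state, fun u hub => ?_, fun u hub => ?_⟩
  · by_cases huP : u ∈ P
    · rw [h.mem_state_iff u hub]
      refine forall_congr' fun w => imp_congr_right fun hadj => ?_
      by_cases hwP : w ∈ P
      · rw [hP w hwP u huP]
      · have hwM : w ∉ M := fun hwM => hN w u hwM hwP huP hadj
        tauto
    · by_cases huM : u ∈ M
      · refine iff_of_true huM fun w hadj hlt hwM => ?_
        by_cases hwP : w ∈ P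
        · exact hN u w huM huP hwP hadj.symm
        · exact (h.mem_state_iff u hub).1 huM w hadj ((hPc w hwP u huP).2 hlt) hwM
      · refine iff_of_false huM fun hall => ?_
        obtain ⟨w, hadj, hlt, hwM, hwP⟩ := hdom u huM huP
        exact hall w hadj ((hPc w hwP u huP).1 hlt) hwM
  · by_cases huP : u ∈ P
    · refine iff_of_true huP ?_
      by_cases huM : u ∈ M
      · obtain ⟨-, w, hwP, hadj, hlt⟩ | ⟨huM', -⟩ := (h.mem_iff u hub).1 huP
        · exact Or.inl ⟨huM, w, hwP, hadj, (hP w hwP u huP).1 hlt⟩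
        · exact absurd huM huM'
      · exact Or.inr ⟨huM, fun w hadj _ hwM =>
          by_contra fun hwP => hN w u hwM hwP huP hadj⟩
    · refine iff_of_false huP ?_
      rintro (⟨huM, w, hwP, hadj, -⟩ | ⟨huM, hall⟩)
      · exact hN u w huM huP hwP hadj.symm
      · obtain ⟨w, hadj, hlt, hwM, hwP⟩ := hdom u huM huP
        exact hwP (hall w hadj ((hPc w hwP u huP).1 hlt) hwM)

end IsInfluence

theorem mem_greedySet_iff (G : SimpleGraph V) (π : V → ℕ) (v : V) :
    v ∈ greedySet G π ↔ ∀ u, G.Adj u v → π u < π v → u ∉ greedySet G π := by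
  change greedy G π v ↔ ∀ u, G.Adj u v → π u < π v → ¬ greedy G π u
  rw [greedy]

theorem mem_Sunion_self (H : SimpleGraph V) (M : Set V) (π : V → ℕ) (b : V) :
    b ∈ Sunion H M π b :=
  Set.mem_iUnion.2 ⟨0, by simp [Slayer]⟩

theorem mem_Sunion_iff [Finite V] (H : SimpleGraph V) (M : Set V) (π : V → ℕ) {b u : V}
    (hu : u ≠ b) :
    u ∈ Sunion H M π b ↔ (u ∈ M ∧ ∃ w ∈ Sunion H M π b, H.Adj w u ∧ π w < π u) ∨
      (u ∉ M ∧ ∀ w, H.Adj w u → π w < π u → w ∈ M → w ∈ Sunion H M π b) := by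
  constructor
  · intro h
    obtain ⟨i, hi⟩ := Set.mem_iUnion.1 h
    cases i with
    | zero => exact absurd (by simpa [Slayer] using hi) hu
    | succ i =>
      rw [Slayer] at hi
      obtain ⟨huM, w, hw, hadj⟩ | ⟨huM, hall⟩ := hi
      · exact Or.inl ⟨huM, w, Set.mem_iUnion.2 ⟨i, hw⟩, hadj⟩
      · refine Or.inr ⟨huM, fun w hadj hlt hwM => ?_⟩
        obtain ⟨j, -, hj⟩ := hall w ⟨hadj, hlt⟩ hwM
        exact Set.mem_iUnion.2 ⟨j, hj⟩
  · rintro (⟨huM, w, hw, hadj⟩ | ⟨huM, hall⟩)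
    · obtain ⟨i, hi⟩ := Set.mem_iUnion.1 hw
      refine Set.mem_iUnion.2 ⟨i + 1, ?_⟩
      rw [Slayer]
      exact Or.inl ⟨huM, w, hi, hadj⟩
    · have hlayer : ∀ w, ∃ j, H.Adj w u → π w < π u → w ∈ M → w ∈ Slayer H M π b j := by
        intro w
        by_cases hw : H.Adj w u ∧ π w < π u ∧ w ∈ M
        · obtain ⟨j, hj⟩ := Set.mem_iUnion.1 (hall w hw.1 hw.2.1 hw.2.2)
          exact ⟨j, fun _ _ _ => hj⟩
        · exact ⟨0, fun h₁ h₂ h₃ => absurd ⟨h₁, h₂, h₃⟩ hw⟩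
      choose j hj using hlayer
      obtain ⟨i, hi⟩ := Set.Finite.bddAbove (Set.finite_range j)
      refine Set.mem_iUnion.2 ⟨i + 1, ?_⟩
      rw [Slayer]
      exact Or.inr ⟨huM, fun w hw hwM =>
        ⟨j w, hi (Set.mem_range_self w), hj w hw.1 hw.2 hwM⟩⟩

/-- The permutation of `Fin n` that moves the least element of `T` to the place of its `j`-th
element, shifts the elements in between back by one place in `T` and fixes all others. -/
def finsetRotate {n : ℕ} (T : Finset (Fin n)) (j : Fin T.card) : Equiv.Perm (Fin n) :=
  Equiv.Perm.ofSubtype (p := (· ∈ T))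
    ((T.orderIsoOfFin rfl).toEquiv.permCongr j.cycleRange.symm)

section Rotate

variable {n : ℕ} {T : Finset (Fin n)}

theorem finsetRotate_of_notMem (j : Fin T.card) {t : Fin n} (ht : t ∉ T) :
    finsetRotate T j t = t :=
  Equiv.Perm.ofSubtype_apply_of_not_mem _ ht

theorem finsetRotate_of_mem (j : Fin T.card) {t : Fin n} (ht : t ∈ T) :
    finsetRotate T j t =
      T.orderIsoOfFin rfl (j.cycleRange.symm ((T.orderIsoOfFin rfl).symm ⟨t, ht⟩)) :=
  Equiv.Perm.ofSubtype_apply_of_mem _ ht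

theorem finsetRotate_mem (j : Fin T.card) {t : Fin n} (ht : t ∈ T) : finsetRotate T j t ∈ T := by
  rw [finsetRotate_of_mem j ht]
  exact Subtype.property _

theorem cycleRange_symm_lt {k : ℕ} (j : Fin k) {x y : Fin k} (hx : (x : ℕ) ≠ 0) (hxy : x < y) :
    j.cycleRange.symm x < j.cycleRange.symm y := by
  cases k with
  | zero => exact x.elim0
  | succ k =>
    obtain ⟨x, rfl⟩ := Fin.exists_succ_eq.2 (show x ≠ 0 from fun e => hx (by rw [e]; rfl))
    obtain ⟨y, rfl⟩ := Fin.exists_succ_eq.2 (Fin.ne_zero_of_lt hxy)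
    rw [Fin.cycleRange_symm_succ, Fin.cycleRange_symm_succ]
    exact Fin.strictMono_succAbove j (Fin.succ_lt_succ_iff.1 hxy)

variable {m : Fin n}

theorem orderIsoOfFin_symm_least (hm : m ∈ T) (hle : ∀ t ∈ T, m ≤ t) :
    ((T.orderIsoOfFin rfl).symm ⟨m, hm⟩ : ℕ) = 0 := by
  have hpos : 0 < T.card := Finset.card_pos.2 ⟨m, hm⟩
  have h : (T.orderIsoOfFin rfl).symm ⟨m, hm⟩ ≤ ⟨0, hpos⟩ := by
    rw [OrderIso.symm_apply_le]
    exact hle _ (Subtype.property _)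
  exact Nat.le_zero.1 h

theorem finsetRotate_least (hm : m ∈ T) (hle : ∀ t ∈ T, m ≤ t) (j : Fin T.card) :
    finsetRotate T j m = T.orderIsoOfFin rfl j := by
  have : NeZero T.card := ⟨(Finset.card_pos.2 ⟨m, hm⟩).ne'⟩
  rw [finsetRotate_of_mem j hm,
    show (T.orderIsoOfFin rfl).symm ⟨m, hm⟩ = 0 from
      Fin.ext (by rw [orderIsoOfFin_symm_least hm hle]; rfl),
    Fin.cycleRange_symm_zero]

theorem finsetRotate_lt (hm : m ∈ T) (hle : ∀ t ∈ T, m ≤ t) (j : Fin T.card) {s t : Fin n}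
    (hs : s ∈ T) (ht : t ∈ T) (hsm : s ≠ m) (hst : s < t) :
    finsetRotate T j s < finsetRotate T j t := by
  rw [finsetRotate_of_mem j hs, finsetRotate_of_mem j ht, Subtype.coe_lt_coe,
    OrderIso.lt_iff_lt]
  refine cycleRange_symm_lt j (fun h0 => hsm ?_) ((OrderIso.lt_iff_lt _).2 hst)
  have h := (T.orderIsoOfFin rfl).symm.injective
    (Fin.ext (h0.trans (orderIsoOfFin_symm_least hm hle).symm))
  exact congrArg Subtype.val h

theorem finsetRotate_lt_iff (hm : m ∈ T) (hle : ∀ t ∈ T, m ≤ t) (j : Fin T.card) {s t : Fin n}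
    (hs : s ∈ T) (ht : t ∈ T) (hsm : s ≠ m) (htm : t ≠ m) :
    finsetRotate T j s < finsetRotate T j t ↔ s < t := by
  refine ⟨fun h => ?_, finsetRotate_lt hm hle j hs ht hsm⟩
  rcases lt_trichotomy s t with h' | h' | h'
  · exact h'
  · exact absurd h (h' ▸ lt_irrefl _)
  · exact absurd h (finsetRotate_lt hm hle j ht hs htm h').not_gt

end Rotate

section Counting

variable [Fintype V]

theorem toOrd_injective (π : V ≃ Fin (Fintype.card V)) : Function.Injective (toOrd π) :=
  fun _ _ h => π.injective (Fin.ext h)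

/-- The order obtained from `π` by delaying the first element of `P` to the `j`-th place in `P`. -/
def delayFirst (P : Finset V) (π : V ≃ Fin (Fintype.card V)) (j : Fin (P.map π.toEmbedding).card) :
    V ≃ Fin (Fintype.card V) :=
  π.trans (finsetRotate (P.map π.toEmbedding) j)

section Delay

variable {P : Finset V} {π : V ≃ Fin (Fintype.card V)} {b : V}

theorem delayFirst_of_notMem (j : Fin (P.map π.toEmbedding).card) {v : V} (hv : v ∉ P) :
    delayFirst P π j v = π v :=
  finsetRotate_of_notMem j (by simpa using hv)

theorem map_delayFirst (j : Fin (P.map π.toEmbedding).card) :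
    P.map (delayFirst P π j).toEmbedding = P.map π.toEmbedding := by
  refine Finset.eq_of_subset_of_card_le (fun t ht => ?_) (by simp)
  obtain ⟨v, hv, rfl⟩ := Finset.mem_map.1 ht
  exact finsetRotate_mem j (Finset.mem_map_of_mem π.toEmbedding hv)

theorem sameOrderOn_pushFirst_delayFirst (hb : b ∈ P) (hle : ∀ v ∈ P, π b ≤ π v)
    (j : Fin (P.map π.toEmbedding).card) :
    sameOrderOn (toOrd π) (pushFirst (toOrd (delayFirst P π j)) b) P := by
  have hmem : ∀ v ∈ P, π v ∈ P.map π.toEmbedding := fun v hv =>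
    Finset.mem_map_of_mem π.toEmbedding hv
  have hleast : ∀ t ∈ P.map π.toEmbedding, π b ≤ t := by
    intro t ht
    obtain ⟨v, hv, rfl⟩ := Finset.mem_map.1 ht
    exact hle v hv
  intro x hx y hy
  have hxle : toOrd π b ≤ toOrd π x := hle x hx
  have hyle : toOrd π b ≤ toOrd π y := hle y hy
  by_cases hxb : x = b
  · subst hxb
    by_cases hyb : y = x
    · simp [hyb]
    · have hne := (toOrd_injective π).ne hyb
      have hlt : toOrd π x < toOrd π y := by omega
      simp [pushFirst, hyb, hlt]
  · by_cases hyb : y = b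
    · subst hyb
      simp [pushFirst, hxb, hxle]
    · have h := finsetRotate_lt_iff (hmem b hb) hleast j (hmem x hx) (hmem y hy)
        (π.injective.ne hxb) (π.injective.ne hyb)
      simp only [pushFirst, hxb, hyb, if_false, add_lt_add_iff_right]
      exact h.symm

theorem sameOrderOn_compl_pushFirst_delayFirst (hb : b ∈ P)
    (j : Fin (P.map π.toEmbedding).card) :
    sameOrderOn (toOrd π) (pushFirst (toOrd (delayFirst P π j)) b) (P : Set V)ᶜ := by
  intro x hx y hy
  have hxb : x ≠ b := fun e => hx (e ▸ hb)
  have hyb : y ≠ b := fun e => hy (e ▸ hb)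
  simp only [pushFirst, hxb, hyb, if_false, add_lt_add_iff_right, toOrd]
  rw [delayFirst_of_notMem j hx, delayFirst_of_notMem j hy]

theorem delayFirst_injective {π' : V ≃ Fin (Fintype.card V)} (hb : b ∈ P)
    (hle : ∀ v ∈ P, π b ≤ π v) (hle' : ∀ v ∈ P, π' b ≤ π' v)
    {j : Fin (P.map π.toEmbedding).card} {j' : Fin (P.map π'.toEmbedding).card}
    (h : delayFirst P π j = delayFirst P π' j') : π = π' ∧ (j : ℕ) = j' := by
  have hT : P.map π.toEmbedding = P.map π'.toEmbedding := by
    rw [← map_delayFirst j, h, map_delayFirst]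
  have hm : π b ∈ P.map π.toEmbedding := Finset.mem_map_of_mem π.toEmbedding hb
  have hm' : π' b ∈ P.map π.toEmbedding := hT ▸ Finset.mem_map_of_mem π'.toEmbedding hb
  have hleast : ∀ t ∈ P.map π.toEmbedding, π b ≤ t := by
    intro t ht
    obtain ⟨v, hv, rfl⟩ := Finset.mem_map.1 ht
    exact hle v hv
  have hleast' : ∀ t ∈ P.map π.toEmbedding, π' b ≤ t := by
    rw [hT]
    intro t ht
    obtain ⟨v, hv, rfl⟩ := Finset.mem_map.1 ht
    exact hle' v hv
  have happ : ∀ v, finsetRotate _ j (π v) = finsetRotate _ j' (π' v) := fun v =>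
    congrArg (fun e => e v) h
  clear h
  generalize P.map π'.toEmbedding = T' at hT j'
  subst hT
  have hj : j = j' := by
    have := happ b
    rw [finsetRotate_least hm hleast, finsetRotate_least hm' hleast'] at this
    exact (Finset.orderIsoOfFin _ rfl).injective (Subtype.ext this)
  subst hj
  exact ⟨Equiv.ext fun v => (finsetRotate _ j).injective (happ v), rfl⟩

end Delay

/-- Delaying `b` inside its influenced set injects the pairs of an order and an element of its
influenced set into the orders in which `a` precedes `b`. -/
theorem sum_card_influence_le [DecidableEq V] {H : SimpleGraph V} {a b : V} {β : Prop}
    {A : Finset (V ≃ Fin (Fintype.card V))} {M : (V ≃ Fin (Fintype.card V)) → Set V}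
    {P : (V ≃ Fin (Fintype.card V)) → Finset V} (hlt : ∀ π ∈ A, toOrd π a < toOrd π b)
    (hinfl : ∀ π ∈ A, IsInfluence H b β (toOrd π) (M π) (P π))
    (hb : ∀ π ∈ A, ∀ w, H.Adj w b → toOrd π w < toOrd π b → w ∉ M π) :
    ∑ π ∈ A, (P π).card ≤
      (Finset.univ.filter fun π : V ≃ Fin (Fintype.card V) => toOrd π a < toOrd π b).card := by
  have hle : ∀ π ∈ A, ∀ v ∈ P π, π b ≤ π v := fun π hπ v hv =>
    (hinfl π hπ).source_le (Finset.mem_coe.2 hv)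
  have hbP : ∀ π ∈ A, b ∈ P π := fun π hπ => Finset.mem_coe.1 (hinfl π hπ).source_mem
  have hpush : ∀ π ∈ A, ∀ j, IsInfluence H b β (pushFirst (toOrd (delayFirst (P π) π j)) b)
      (M π) (P π) := fun π hπ j =>
    (hinfl π hπ).transfer (toOrd_injective π) (hb π hπ)
      (sameOrderOn_pushFirst_delayFirst (hbP π hπ) (hle π hπ) j)
      (sameOrderOn_compl_pushFirst_delayFirst (hbP π hπ) j)
  have hcard : ∑ π ∈ A, (P π).card = (A.sigma fun π =>
      (Finset.univ : Finset (Fin ((P π).map π.toEmbedding).card))).card := by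
    simp [Finset.card_sigma]
  rw [hcard]
  refine Finset.card_le_card_of_injOn (fun p => delayFirst (P p.1) p.1 p.2) ?_ ?_
  · rintro ⟨π, j⟩ hp
    have hπ : π ∈ A := by simpa using hp
    have haP : a ∉ P π := fun ha => (hle π hπ a ha).not_gt (hlt π hπ)
    have hmem : delayFirst (P π) π j b ∈ (P π).map π.toEmbedding := by
      rw [← map_delayFirst j]
      exact Finset.mem_map_of_mem (delayFirst (P π) π j).toEmbedding (hbP π hπ)
    obtain ⟨v, hv, hvb⟩ := Finset.mem_map.1 hmem
    simp only [Finset.coe_filter, Finset.mem_univ, true_and, Set.mem_ofPred_eq]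
    change delayFirst (P π) π j a < delayFirst (P π) π j b
    rw [delayFirst_of_notMem j haP, ← hvb]
    exact lt_of_lt_of_le (hlt π hπ) (hle π hπ v hv)
  · rintro ⟨π, j⟩ hp ⟨π', j'⟩ hp' heq
    have hπ : π ∈ A := by simpa using hp
    have hπ' : π' ∈ A := by simpa using hp'
    dsimp only at heq
    have hP : P π' = P π := by
      have h := hpush π hπ j
      rw [heq] at h
      exact Finset.coe_injective ((hpush π' hπ' j').unique h)
    have hle' := hle π' hπ'
    have key : π = π' ∧ (j : ℕ) = j' := by
      clear hp' hpush
      revert j'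
      rw [hP] at hle' ⊢
      intro j' heq
      exact delayFirst_injective (hbP π hπ) (hle π hπ) hle' heq
    obtain ⟨rfl, hj⟩ := key
    obtain rfl := Fin.ext hj
    rfl

/-- When the changed edge `ab` breaks the invariant at its later endpoint `b`, the set `Sunion` is
the influence of `b` in the common part of the two graphs. -/
theorem isInfluence_Sunion {Gold Gnew : SimpleGraph V} {a b : V}
    (h : (¬ Gold.Adj a b ∧
            ∀ x y, Gnew.Adj x y ↔ Gold.Adj x y ∨ (x = a ∧ y = b) ∨ (x = b ∧ y = a)) ∨
         (Gold.Adj a b ∧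
            ∀ x y, Gnew.Adj x y ↔ Gold.Adj x y ∧ ¬ ((x = a ∧ y = b) ∨ (x = b ∧ y = a))))
    {π : V → ℕ} (hlt : π a < π b) (hbroken : ¬ invAt Gnew (greedySet Gold π) π b) :
    IsInfluence (Gold ⊓ Gnew) b (¬ Gold.Adj a b) π (greedySet Gold π)
        (Sunion Gnew (greedySet Gold π) π b) ∧
      ∀ w, (Gold ⊓ Gnew).Adj w b → π w < π b → w ∉ greedySet Gold π := by
  have hbM := mem_greedySet_iff Gold π b
  have hold : ∀ u, u ≠ b → ∀ w, π w < π u → (Gold.Adj w u ↔ (Gold ⊓ Gnew).Adj w u) := by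
    intro u hu w hw
    rw [SimpleGraph.inf_adj]
    have : ¬ (w = b ∧ u = a) := by
      rintro ⟨rfl, rfl⟩
      exact hw.not_gt hlt
    rcases h with h | h <;> rw [h.2] <;> tauto
  have hnew : ∀ u, u ≠ b → ∀ w, π w < π u → (Gnew.Adj w u ↔ (Gold ⊓ Gnew).Adj w u) := by
    intro u hu w hw
    rw [SimpleGraph.inf_adj]
    have : ¬ (w = b ∧ u = a) := by
      rintro ⟨rfl, rfl⟩
      exact hw.not_gt hlt
    rcases h with h | h <;> rw [h.2] <;> tauto
  have hsrc : (b ∈ greedySet Gold π ↔ ¬ Gold.Adj a b) ∧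
      ∀ w, (Gold ⊓ Gnew).Adj w b → π w < π b → w ∉ greedySet Gold π := by
    rw [invAt] at hbroken
    simp only [SimpleGraph.inf_adj]
    rcases h with ⟨hab, hadj⟩ | ⟨hab, hadj⟩
    · have hb : b ∈ greedySet Gold π := by
        by_contra hb
        refine hbroken (iff_of_false hb fun hall => hb (hbM.2 fun w hw => hall w ?_))
        exact (hadj w b).2 (Or.inl hw)
      exact ⟨iff_of_true hb hab, fun w hw => hbM.1 hb w hw.1⟩
    · have hb : b ∉ greedySet Gold π := fun hb =>
        hbroken (iff_of_true hb fun w hw => hbM.1 hb w ((hadj w b).1 hw).1)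
      refine ⟨iff_of_false hb (not_not.2 hab), fun w hw => ?_⟩
      have hall : ∀ u, Gnew.Adj u b → π u < π b → u ∉ greedySet Gold π := by
        by_contra hall
        exact hbroken (iff_of_false hb hall)
      exact hall w hw.2
  refine ⟨⟨mem_Sunion_self _ _ _ _, hsrc.1, fun u hu => ?_, fun u hu => ?_⟩, hsrc.2⟩
  · rw [mem_greedySet_iff]
    have := hold u hu
    grind
  · rw [mem_Sunion_iff _ _ _ hu]
    have := hnew u hu
    grind

/-- The orders in which `b` is the later endpoint of the changed edge `ab` contribute at most
their number to the total size of the influenced sets. -/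
theorem sum_ncard_Sinfl_le [DecidableEq V] {Gold Gnew : SimpleGraph V} {a b : V}
    (h : (¬ Gold.Adj a b ∧
            ∀ x y, Gnew.Adj x y ↔ Gold.Adj x y ∨ (x = a ∧ y = b) ∨ (x = b ∧ y = a)) ∨
         (Gold.Adj a b ∧
            ∀ x y, Gnew.Adj x y ↔ Gold.Adj x y ∧ ¬ ((x = a ∧ y = b) ∨ (x = b ∧ y = a)))) :
    ∑ π : V ≃ Fin (Fintype.card V) with toOrd π a < toOrd π b,
        (Sinfl Gnew (greedySet Gold (toOrd π)) (toOrd π) b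
          (¬ invAt Gnew (greedySet Gold (toOrd π)) (toOrd π) b)).ncard ≤
      (Finset.univ.filter fun π : V ≃ Fin (Fintype.card V) => toOrd π a < toOrd π b).card := by
  set A := Finset.univ.filter fun π : V ≃ Fin (Fintype.card V) => toOrd π a < toOrd π b ∧
    ¬ invAt Gnew (greedySet Gold (toOrd π)) (toOrd π) b with hA
  have hmem : ∀ π ∈ A, toOrd π a < toOrd π b ∧
      ¬ invAt Gnew (greedySet Gold (toOrd π)) (toOrd π) b := fun π hπ => by simpa [hA] using hπ
  calc
    _ = ∑ π ∈ A, (Sunion Gnew (greedySet Gold (toOrd π)) (toOrd π) b).toFinset.card := by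
      rw [hA, ← Finset.filter_filter, Finset.sum_filter (fun π : V ≃ Fin (Fintype.card V) =>
        ¬ invAt Gnew (greedySet Gold (toOrd π)) (toOrd π) b)]
      refine Finset.sum_congr rfl fun π _ => ?_
      by_cases hinv : invAt Gnew (greedySet Gold (toOrd π)) (toOrd π) b
      · simp [Sinfl, hinv]
      · simp only [Sinfl, hinv, not_false_eq_true, if_true]
        exact Set.ncard_eq_toFinset_card' _
    _ ≤ _ := sum_card_influence_le (H := Gold ⊓ Gnew) (β := ¬ Gold.Adj a b)
      (M := fun π => greedySet Gold (toOrd π)) (fun π hπ => (hmem π hπ).1)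
      (fun π hπ => by
        rw [Set.coe_toFinset]
        exact (isInfluence_Sunion h (hmem π hπ).1 (hmem π hπ).2).1)
      (fun π hπ => (isInfluence_Sunion h (hmem π hπ).1 (hmem π hπ).2).2)

end Counting

/-- For a single edge change, the expected size of the influenced set is at most 1. -/
theorem stmt2 {V : Type*} [Fintype V] [DecidableEq V]
    (Gold Gnew : SimpleGraph V) (a b : V) (hab : a ≠ b)
    (h : (¬ Gold.Adj a b ∧
            ∀ x y, Gnew.Adj x y ↔ Gold.Adj x y ∨ (x = a ∧ y = b) ∨ (x = b ∧ y = a)) ∨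
         (Gold.Adj a b ∧
            ∀ x y, Gnew.Adj x y ↔ Gold.Adj x y ∧ ¬ ((x = a ∧ y = b) ∨ (x = b ∧ y = a)))) :
    (∑ π : V ≃ Fin (Fintype.card V),
        ((Sinfl Gnew (greedySet Gold (toOrd π)) (toOrd π)
            (if toOrd π a < toOrd π b then b else a)
            (¬ invAt Gnew (greedySet Gold (toOrd π)) (toOrd π)
              (if toOrd π a < toOrd π b then b else a))).ncard : ℝ))
      / (Fintype.card (V ≃ Fin (Fintype.card V)) : ℝ) ≤ 1 := by
  have h' : (¬ Gold.Adj b a ∧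
        ∀ x y, Gnew.Adj x y ↔ Gold.Adj x y ∨ (x = b ∧ y = a) ∨ (x = a ∧ y = b)) ∨
      (Gold.Adj b a ∧
        ∀ x y, Gnew.Adj x y ↔ Gold.Adj x y ∧ ¬ ((x = b ∧ y = a) ∨ (x = a ∧ y = b))) := by
    simpa only [Gold.adj_comm b a, or_comm (a := _ = b ∧ _ = a)] using h
  refine div_le_one_of_le₀ ?_ (Nat.cast_nonneg _)
  rw [← Nat.cast_sum, Nat.cast_le,
    ← Finset.sum_filter_add_sum_filter_not _ fun π : V ≃ Fin (Fintype.card V) =>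
      toOrd π a < toOrd π b, ← Finset.card_univ (α := V ≃ Fin (Fintype.card V)),
    ← Finset.card_filter_add_card_filter_not fun π : V ≃ Fin (Fintype.card V) =>
      toOrd π a < toOrd π b]
  have hnot : ∀ π : V ≃ Fin (Fintype.card V),
      ¬ toOrd π a < toOrd π b ↔ toOrd π b < toOrd π a := fun π => by
    have := (toOrd_injective π).ne hab
    omega
  refine add_le_add ?_ ?_
  · refine le_trans (Finset.sum_congr rfl fun π hπ => ?_).le (sum_ncard_Sinfl_le h)
    rw [if_pos (Finset.mem_filter.1 hπ).2]
  · rw [Finset.filter_congr fun π _ => hnot π]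
    refine le_trans (Finset.sum_congr rfl fun π hπ => ?_).le (sum_ncard_Sinfl_le h')
    rw [if_neg ((hnot π).2 (Finset.mem_filter.1 hπ).2)]

end
end

section
/- Let G_old and G_new be finite simple graphs that differ by exactly one vertex v* (one graph is obtained from the other by removing v* and its incident edges). Then, for a uniformly random linear order π on the larger vertex set (inducing a linear order on the smaller one), the expected number of vertices u ≠ v* that belong to exactly one of M(G_old,π) and M(G_new,π) is at most 1. -/
open scoped Classical

noncomputable section

variable {V : Type*}

theorem greedy_iff (G : SimpleGraph V) (p : V → ℕ) (v : V) :
    greedy G p v ↔ ∀ u, G.Adj u v → p u < p v → ¬ greedy G p u := by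
  rw [greedy]

/-- The influenced set of the vertex `v`, as if `v` came first in the order: `H` is `G` with `v`
isolated, a vertex of the greedy MIS of `H` is influenced when some earlier neighbor is, and a
vertex outside of it is influenced when all its earlier neighbors in the MIS are. -/
def infl (G H : SimpleGraph V) (p : V → ℕ) (v u : V) : Prop :=
  u = v ∨
  (greedy H p u ∧ (G.Adj v u ∨ ∃ w, H.Adj w u ∧ ∃ _hlt : p w < p u, infl G H p v w)) ∨
  (¬ greedy H p u ∧ ∀ w, H.Adj w u → ∀ _hlt : p w < p u, greedy H p w → infl G H p v w)
termination_by p u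

theorem infl_iff (G H : SimpleGraph V) (p : V → ℕ) (v u : V) :
    infl G H p v u ↔ u = v ∨
      (greedy H p u ∧ (G.Adj v u ∨ ∃ w, H.Adj w u ∧ p w < p u ∧ infl G H p v w)) ∨
      (¬ greedy H p u ∧ ∀ w, H.Adj w u → p w < p u → greedy H p w → infl G H p v w) := by
  rw [infl]
  simp only [exists_prop]

/-- `H` is obtained from `G` by isolating the vertex `v`. -/
def IsIsolation (G H : SimpleGraph V) (v : V) : Prop :=
  ∀ x y, H.Adj x y ↔ G.Adj x y ∧ x ≠ v ∧ y ≠ v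

theorem infl_self (G H : SimpleGraph V) (p : V → ℕ) (v : V) : infl G H p v v :=
  (infl_iff ..).2 (Or.inl rfl)

theorem IsIsolation.greedy_self {G H : SimpleGraph V} {v : V} (h : IsIsolation G H v)
    (p : V → ℕ) : greedy H p v :=
  (greedy_iff ..).2 fun u hu _ => absurd rfl ((h u v).1 hu).2.2

theorem IsIsolation.not_adj_infl {G H : SimpleGraph V} {v : V} (h : IsIsolation G H v)
    {p : V → ℕ} (hp : Function.Injective p) {u w : V} (hu : greedy H p u)
    (hu' : ¬ infl G H p v u) (hw : infl G H p v w) : ¬ H.Adj w u := by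
  intro hadj
  rcases lt_trichotomy (p w) (p u) with hlt | heq | hgt
  · exact hu' ((infl_iff ..).2 (Or.inr (Or.inl ⟨hu, Or.inr ⟨w, hadj, hlt, hw⟩⟩)))
  · exact hadj.ne (hp heq)
  · have hwM : ¬ greedy H p w := fun hw' => (greedy_iff ..).1 hw' u hadj.symm hgt hu
    rcases (infl_iff ..).1 hw with rfl | ⟨h1, _⟩ | ⟨_, h2⟩
    · exact ((h w u).1 hadj).2.1 rfl
    · exact hwM h1
    · exact hu' (h2 u hadj.symm hgt hu)

theorem exists_not_infl {G H : SimpleGraph V} {v : V} {p : V → ℕ} {u : V}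
    (hu : ¬ greedy H p u) (hu' : ¬ infl G H p v u) :
    ∃ w, H.Adj w u ∧ p w < p u ∧ greedy H p w ∧ ¬ infl G H p v w := by
  by_contra! hc
  exact hu' ((infl_iff ..).2 (Or.inr (Or.inr ⟨hu, hc⟩)))

theorem IsIsolation.exists_infl {G H : SimpleGraph V} {v : V} (h : IsIsolation G H v)
    {p : V → ℕ} {u : V} (hu : ¬ greedy H p u) (hu' : infl G H p v u) :
    ∃ w, H.Adj w u ∧ p w < p u ∧ greedy H p w ∧ infl G H p v w := by
  rcases (infl_iff ..).1 hu' with rfl | ⟨h1, _⟩ | ⟨_, h2⟩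
  · exact absurd (h.greedy_self p) hu
  · exact absurd h1 hu
  · by_contra! hc
    exact hu ((greedy_iff ..).2 fun w hw hlt hM => hc w hw hlt hM (h2 w hw hlt hM))

section Invariance

variable {G H : SimpleGraph V} {v : V} {p q : V → ℕ}

theorem IsIsolation.greedy_congr (h : IsIsolation G H v) (hp : Function.Injective p)
    (hT : sameOrderOn p q {x | infl G H p v x ∧ x ≠ v})
    (hT' : sameOrderOn p q {x | ¬ infl G H p v x}) (u : V) :
    greedy H q u ↔ greedy H p u := by
  induction hn : q u using Nat.strong_induction_on generalizing u with
  | _ n ih =>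
    subst hn
    rw [greedy_iff H q]
    constructor
    · intro hq
      by_contra hu
      obtain ⟨w, hadj, hlt, hw⟩ : ∃ w, H.Adj w u ∧ q w < q u ∧ greedy H p w := by
        by_cases hu' : infl G H p v u
        · obtain ⟨w, hadj, hlt, hw, hw'⟩ := h.exists_infl hu hu'
          have hne := ((h w u).1 hadj).2
          exact ⟨w, hadj, (hT w ⟨hw', hne.1⟩ u ⟨hu', hne.2⟩).1 hlt, hw⟩
        · obtain ⟨w, hadj, hlt, hw, hw'⟩ := exists_not_infl hu hu'
          exact ⟨w, hadj, (hT' w hw' u hu').1 hlt, hw⟩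
      exact hq w hadj hlt ((ih _ hlt w rfl).2 hw)
    · intro hu w hadj hlt hw
      rw [ih _ hlt w rfl] at hw
      have hne := ((h w u).1 hadj).2
      by_cases hu' : infl G H p v u <;> by_cases hw' : infl G H p v w
      · exact (greedy_iff ..).1 hu w hadj ((hT w ⟨hw', hne.1⟩ u ⟨hu', hne.2⟩).2 hlt) hw
      · exact h.not_adj_infl hp hw hw' hu' hadj.symm
      · exact h.not_adj_infl hp hu hu' hw' hadj
      · exact (greedy_iff ..).1 hu w hadj ((hT' w hw' u hu').2 hlt) hw

theorem IsIsolation.infl_congr (h : IsIsolation G H v) (hp : Function.Injective p)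
    (hT : sameOrderOn p q {x | infl G H p v x ∧ x ≠ v})
    (hT' : sameOrderOn p q {x | ¬ infl G H p v x}) (u : V) :
    infl G H q v u ↔ infl G H p v u := by
  have hM := h.greedy_congr hp hT hT'
  induction hn : q u using Nat.strong_induction_on generalizing u with
  | _ n ih =>
    subst hn
    rw [infl_iff G H q]
    simp only [hM]
    constructor
    · rintro (rfl | ⟨hu, hadj | ⟨w, hadj, hlt, hw⟩⟩ | ⟨hu, hall⟩)
      · exact infl_self ..
      · exact (infl_iff ..).2 (Or.inr (Or.inl ⟨hu, Or.inl hadj⟩))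
      · replace hw := (ih _ hlt w rfl).1 hw
        by_contra hu'
        exact h.not_adj_infl hp hu hu' hw hadj
      · by_contra hu'
        obtain ⟨w, hadj, hlt, hw, hw'⟩ := exists_not_infl hu hu'
        have hlt' := (hT' w hw' u hu').1 hlt
        exact hw' ((ih _ hlt' w rfl).1 (hall w hadj hlt' hw))
    · intro hu'
      rcases (infl_iff ..).1 hu' with rfl | ⟨hu, hadj | ⟨w, hadj, hlt, hw⟩⟩ | ⟨hu, hall⟩
      · exact Or.inl rfl
      · exact Or.inr (Or.inl ⟨hu, Or.inl hadj⟩)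
      · have hne := ((h w u).1 hadj).2
        have hlt' := (hT w ⟨hw, hne.1⟩ u ⟨hu', hne.2⟩).1 hlt
        exact Or.inr (Or.inl ⟨hu, Or.inr ⟨w, hadj, hlt', (ih _ hlt' w rfl).2 hw⟩⟩)
      · refine Or.inr (Or.inr ⟨hu, fun w hadj hlt hw => (ih _ hlt w rfl).2 ?_⟩)
        by_contra hw'
        exact h.not_adj_infl hp hw hw' hu' hadj.symm

end Invariance

section Difference

variable {G H : SimpleGraph V} {v : V} {p : V → ℕ}

theorem IsIsolation.infl_of_greedy_ne (h : IsIsolation G H v) (u : V)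
    (hu : ¬ (greedy G p u ↔ greedy H p u)) : infl G H p v u := by
  induction hn : p u using Nat.strong_induction_on generalizing u with
  | _ n ih =>
    subst hn
    by_cases huv : u = v
    · exact huv ▸ infl_self ..
    rw [infl_iff]
    by_cases hH : greedy H p u
    · have hG : ¬ greedy G p u := by tauto
      rw [greedy_iff] at hG
      push Not at hG
      obtain ⟨w, hadj, hlt, hw⟩ := hG
      refine Or.inr (Or.inl ⟨hH, ?_⟩)
      by_cases hwv : w = v
      · exact Or.inl (hwv ▸ hadj)
      · have hadj' := (h w u).2 ⟨hadj, hwv, huv⟩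
        have := (greedy_iff ..).1 hH w hadj' hlt
        exact Or.inr ⟨w, hadj', hlt, ih _ hlt w (by tauto) rfl⟩
    · have hG : greedy G p u := by tauto
      refine Or.inr (Or.inr ⟨hH, fun w hadj hlt hw => ih _ hlt w ?_ rfl⟩)
      have := (greedy_iff ..).1 hG w ((h w u).1 hadj).1 hlt
      tauto

theorem IsIsolation.greedy_iff_of_not_greedy (h : IsIsolation G H v) (hv : ¬ greedy G p v)
    (u : V) (huv : u ≠ v) : greedy G p u ↔ greedy H p u := by
  induction hn : p u using Nat.strong_induction_on generalizing u with
  | _ n ih =>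
    subst hn
    rw [greedy_iff G, greedy_iff H]
    constructor
    · intro hG w hadj hlt
      have ha := (h w u).1 hadj
      rw [← ih _ hlt w ha.2.1 rfl]
      exact hG w ha.1 hlt
    · intro hH w hadj hlt
      by_cases hwv : w = v
      · exact hwv ▸ hv
      · rw [ih _ hlt w hwv rfl]
        exact hH w ((h w u).2 ⟨hadj, hwv, huv⟩) hlt

theorem IsIsolation.greedy_iff_of_lt (h : IsIsolation G H v) (u : V) (huv : p u < p v) :
    greedy G p u ↔ greedy H p u := by
  induction hn : p u using Nat.strong_induction_on generalizing u with
  | _ n ih =>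
    subst hn
    rw [greedy_iff G, greedy_iff H]
    refine forall_congr' fun w => ?_
    have hu : u ≠ v := by rintro rfl; exact lt_irrefl _ huv
    constructor
    · intro hG hadj hlt
      rw [← ih _ hlt w (hlt.trans huv) rfl]
      exact hG ((h w u).1 hadj).1 hlt
    · intro hH hadj hlt
      have hw : w ≠ v := by rintro rfl; exact lt_asymm hlt huv
      rw [ih _ hlt w (hlt.trans huv) rfl]
      exact hH ((h w u).2 ⟨hadj, hw, hu⟩) hlt

theorem IsIsolation.lt_of_infl (h : IsIsolation G H v) (hp : Function.Injective p)
    (hv : greedy G p v) (u : V) (huv : u ≠ v) (hu : infl G H p v u) : p v < p u := by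
  induction hn : p u using Nat.strong_induction_on generalizing u with
  | _ n ih =>
    subst hn
    by_cases hM : greedy H p u
    · rcases (infl_iff ..).1 hu with rfl | ⟨_, hadj | ⟨w, hadj, hlt, hw⟩⟩ | ⟨hM', _⟩
      · exact absurd rfl huv
      · rcases lt_trichotomy (p v) (p u) with hlt | heq | hgt
        · exact hlt
        · exact absurd (hp heq).symm huv
        · exact absurd ((h.greedy_iff_of_lt u hgt).2 hM)
            ((greedy_iff ..).1 hv u hadj.symm hgt)
      · exact (ih _ hlt w ((h w u).1 hadj).2.1 hw rfl).trans hlt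
      · exact absurd hM hM'
    · obtain ⟨w, hadj, hlt, -, hw⟩ := h.exists_infl hM hu
      exact (ih _ hlt w ((h w u).1 hadj).2.1 hw rfl).trans hlt

end Difference

section Counting

variable [Fintype V]

/-- The influenced set as a finset. -/
def inflSet (G H : SimpleGraph V) (v : V) (π : V ≃ Fin (Fintype.card V)) : Finset V :=
  Finset.univ.filter fun u => infl G H (toOrd π) v u

/-- The number of influenced vertices that precede `v`. -/
def inflRank (G H : SimpleGraph V) (v : V) (π : V ≃ Fin (Fintype.card V)) : ℕ :=
  ((inflSet G H v π).filter fun u => π u < π v).card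

theorem mem_inflSet {G H : SimpleGraph V} {v : V} {π : V ≃ Fin (Fintype.card V)} {u : V} :
    u ∈ inflSet G H v π ↔ infl G H (toOrd π) v u := by
  simp [inflSet]

/-- `s` is the first influenced vertex after `v`. -/
def IsNextInfl (G H : SimpleGraph V) (v : V) (π : V ≃ Fin (Fintype.card V)) (s : V) : Prop :=
  s ∈ inflSet G H v π ∧ π v < π s ∧ ∀ x ∈ inflSet G H v π, π v < π x → π s ≤ π x

theorem exists_isNextInfl {G H : SimpleGraph V} {v : V} {π : V ≃ Fin (Fintype.card V)}
    (h : inflRank G H v π + 1 < (inflSet G H v π).card) : ∃ s, IsNextInfl G H v π s := by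
  have hne : ((inflSet G H v π).filter fun u => π v < π u).Nonempty := by
    by_contra hc
    rw [Finset.not_nonempty_iff_eq_empty, Finset.filter_eq_empty_iff] at hc
    have hsub : inflSet G H v π ⊆ insert v ((inflSet G H v π).filter fun u => π u < π v) := by
      intro x hx
      rcases lt_trichotomy (π x) (π v) with hlt | heq | hgt
      · simp [hx, hlt]
      · simp [π.injective heq]
      · exact absurd hgt (hc hx)
    have h1 := Finset.card_le_card hsub
    have h2 := Finset.card_insert_le v ((inflSet G H v π).filter fun u => π u < π v)
    unfold inflRank at h
    omega
  obtain ⟨s, hs, hmin⟩ := Finset.exists_min_image _ (fun u => π u) hne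
  rw [Finset.mem_filter] at hs
  exact ⟨s, hs.1, hs.2, fun x hx hlt => hmin x (Finset.mem_filter.2 ⟨hx, hlt⟩)⟩

section Swap

variable {G H : SimpleGraph V} {v s : V} {π : V ≃ Fin (Fintype.card V)}

theorem IsNextInfl.lt_iff (hs : IsNextInfl G H v π s) {x : V} (hx : x ∈ inflSet G H v π)
    (hxv : x ≠ v) : π x < π v ↔ π x < π s := by
  constructor
  · exact fun hlt => hlt.trans hs.2.1
  · intro hlt
    rcases lt_trichotomy (π x) (π v) with h1 | h1 | h1
    · exact h1
    · exact absurd (π.injective h1) hxv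
    · exact absurd hlt (not_lt.2 (hs.2.2 x hx h1))

theorem IsNextInfl.lt_iff' (hs : IsNextInfl G H v π s) {x : V} (hx : x ∈ inflSet G H v π)
    (hxv : x ≠ v) (hxs : x ≠ s) : π v < π x ↔ π s < π x := by
  have h := hs.lt_iff hx hxv
  have h1 : π x ≠ π v := fun h => hxv (π.injective h)
  have h2 : π x ≠ π s := fun h => hxs (π.injective h)
  rw [← not_iff_not, not_lt, not_lt, h1.le_iff_lt, h2.le_iff_lt, h]

variable [DecidableEq V]

theorem swap_trans_apply_left (v s : V) (π : V ≃ Fin (Fintype.card V)) :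
    ((Equiv.swap v s).trans π) v = π s := by simp

theorem swap_trans_apply_right (v s : V) (π : V ≃ Fin (Fintype.card V)) :
    ((Equiv.swap v s).trans π) s = π v := by simp

theorem swap_trans_apply_of_ne {x : V} (hv : x ≠ v) (hs : x ≠ s) :
    ((Equiv.swap v s).trans π) x = π x := by
  simp [Equiv.swap_apply_of_ne_of_ne hv hs]

theorem IsNextInfl.inflSet_swap (hiso : IsIsolation G H v) (hs : IsNextInfl G H v π s) :
    inflSet G H v ((Equiv.swap v s).trans π) = inflSet G H v π := by
  ext u
  rw [mem_inflSet, mem_inflSet]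
  refine hiso.infl_congr (toOrd_injective π) ?_ ?_ u
  · rintro x ⟨hx, hxv⟩ y ⟨hy, hyv⟩
    change π x < π y ↔ ((Equiv.swap v s).trans π) x < ((Equiv.swap v s).trans π) y
    by_cases hxs : x = s <;> by_cases hys : y = s
    · subst hxs hys; simp
    · subst hxs
      rw [swap_trans_apply_right, swap_trans_apply_of_ne hyv hys]
      exact (hs.lt_iff' (mem_inflSet.2 hy) hyv hys).symm
    · subst hys
      rw [swap_trans_apply_right, swap_trans_apply_of_ne hxv hxs]
      exact (hs.lt_iff (mem_inflSet.2 hx) hxv).symm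
    · rw [swap_trans_apply_of_ne hxv hxs, swap_trans_apply_of_ne hyv hys]
  · have key : ∀ x, ¬ infl G H (toOrd π) v x → ((Equiv.swap v s).trans π) x = π x := by
      intro x hx
      refine swap_trans_apply_of_ne ?_ ?_
      · rintro rfl; exact hx (infl_self ..)
      · rintro rfl; exact hx (mem_inflSet.1 hs.1)
    intro x hx y hy
    change π x < π y ↔ ((Equiv.swap v s).trans π) x < ((Equiv.swap v s).trans π) y
    rw [key x hx, key y hy]

theorem IsNextInfl.inflRank_swap (hiso : IsIsolation G H v) (hs : IsNextInfl G H v π s) :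
    inflRank G H v ((Equiv.swap v s).trans π) = inflRank G H v π + 1 := by
  have hsv : s ≠ v := by rintro rfl; exact lt_irrefl _ hs.2.1
  unfold inflRank
  rw [hs.inflSet_swap hiso, ← Finset.card_insert_of_notMem (a := s)
    (s := (inflSet G H v π).filter fun u => π u < π v) (by simp [hs.2.1.le])]
  congr 1
  ext x
  rw [Finset.mem_insert, Finset.mem_filter, Finset.mem_filter, swap_trans_apply_left]
  by_cases hxs : x = s
  · subst hxs
    rw [swap_trans_apply_right]
    simp [hs.1, hs.2.1]
  by_cases hxv : x = v
  · subst hxv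
    rw [swap_trans_apply_left]
    simp [hxs]
  rw [swap_trans_apply_of_ne hxv hxs]
  simp only [hxs, false_or]
  exact and_congr_right fun hx => (hs.lt_iff hx hxv).symm

theorem IsNextInfl.le_of_swap (hs : IsNextInfl G H v π s) {x : V} (hx : x ∈ inflSet G H v π)
    (hlt : ((Equiv.swap v s).trans π) x < ((Equiv.swap v s).trans π) v) :
    ((Equiv.swap v s).trans π) x ≤ ((Equiv.swap v s).trans π) s := by
  by_cases hxs : x = s
  · rw [hxs]
  have hxv : x ≠ v := by rintro rfl; exact lt_irrefl _ hlt
  rw [swap_trans_apply_of_ne hxv hxs] at hlt ⊢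
  rw [swap_trans_apply_left] at hlt
  rw [swap_trans_apply_right]
  exact ((hs.lt_iff hx hxv).2 hlt).le

theorem IsNextInfl.swap_injective (hiso : IsIsolation G H v) {π' : V ≃ Fin (Fintype.card V)}
    {s' : V} (hs : IsNextInfl G H v π s) (hs' : IsNextInfl G H v π' s')
    (heq : (Equiv.swap v s).trans π = (Equiv.swap v s').trans π') : π = π' := by
  have hset : inflSet G H v π = inflSet G H v π' := by
    rw [← hs.inflSet_swap hiso, heq, hs'.inflSet_swap hiso]
  have hlt : ((Equiv.swap v s).trans π) s < ((Equiv.swap v s).trans π) v := by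
    rw [swap_trans_apply_left, swap_trans_apply_right]; exact hs.2.1
  have hlt' : ((Equiv.swap v s').trans π') s' < ((Equiv.swap v s').trans π') v := by
    rw [swap_trans_apply_left, swap_trans_apply_right]; exact hs'.2.1
  have h1 := hs'.le_of_swap (hset ▸ hs.1) (heq ▸ hlt)
  have h2 := hs.le_of_swap (hset ▸ hs'.1) (heq ▸ hlt')
  rw [heq] at h2
  have hss : s = s' := ((Equiv.swap v s').trans π').injective (le_antisymm h1 h2)
  subst hss
  ext x
  have := congrArg (fun e => e (Equiv.swap v s x)) heq
  simpa using congrArg Fin.val this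

end Swap

variable {G H : SimpleGraph V} {v : V}

theorem IsIsolation.ncard_symmDiff_le (hiso : IsIsolation G H v)
    (π : V ≃ Fin (Fintype.card V)) :
    {u : V | u ≠ v ∧ ¬ (greedy G (toOrd π) u ↔ greedy H (toOrd π) u)}.ncard ≤
      if inflRank G H v π = 0 then (inflSet G H v π).card else 0 := by
  by_cases hv : greedy G (toOrd π) v
  · have h0 : inflRank G H v π = 0 := by
      rw [inflRank, Finset.card_eq_zero, Finset.filter_eq_empty_iff]
      intro u hu hlt
      have huv : u ≠ v := by rintro rfl; exact lt_irrefl _ hlt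
      exact lt_asymm hlt (hiso.lt_of_infl (toOrd_injective π) hv u huv (mem_inflSet.1 hu))
    rw [if_pos h0, ← Set.ncard_coe_finset]
    exact Set.ncard_le_ncard
      (fun u hu => Finset.mem_coe.2 (mem_inflSet.2 (hiso.infl_of_greedy_ne u hu.2)))
  · have : {u : V | u ≠ v ∧ ¬ (greedy G (toOrd π) u ↔ greedy H (toOrd π) u)} = ∅ :=
      Set.eq_empty_of_forall_notMem
        fun u hu => hu.2 (hiso.greedy_iff_of_not_greedy hv u hu.1)
    simp [this]

variable [DecidableEq V]

theorem card_inflRank_zero_le (hiso : IsIsolation G H v) (m j : ℕ) (hj : j ≤ m) :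
    (Finset.univ.filter fun π => inflRank G H v π = 0 ∧ m < (inflSet G H v π).card).card ≤
      (Finset.univ.filter fun π => inflRank G H v π = j ∧ m < (inflSet G H v π).card).card := by
  induction j with
  | zero => exact le_rfl
  | succ j ih =>
    refine (ih (by omega)).trans ?_
    have hex : ∀ π : V ≃ Fin (Fintype.card V), ∃ s,
        inflRank G H v π = j ∧ m < (inflSet G H v π).card → IsNextInfl G H v π s := by
      intro π
      by_cases hπ : inflRank G H v π = j ∧ m < (inflSet G H v π).card
      · obtain ⟨s, hs⟩ := exists_isNextInfl (G := G) (H := H) (v := v) (π := π) (by omega)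
        exact ⟨s, fun _ => hs⟩
      · exact ⟨v, fun h => absurd h hπ⟩
    choose s hs using hex
    refine Finset.card_le_card_of_injOn (fun π => (Equiv.swap v (s π)).trans π) ?_ ?_
    · intro π hπ
      simp only [Finset.coe_filter, Finset.mem_univ, true_and, Set.mem_ofPred_eq] at hπ ⊢
      have hn := hs π hπ
      rw [hn.inflRank_swap hiso, hn.inflSet_swap hiso, hπ.1]
      exact ⟨rfl, hπ.2⟩
    · intro π hπ π' hπ' heq
      simp only [Finset.coe_filter, Finset.mem_univ, true_and, Set.mem_ofPred_eq] at hπ hπ'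
      exact (hs π hπ).swap_injective hiso (hs π' hπ') heq

theorem sum_card_inflSet_le (hiso : IsIsolation G H v) :
    ∑ π, (if inflRank G H v π = 0 then (inflSet G H v π).card else 0) ≤
      Fintype.card (V ≃ Fin (Fintype.card V)) := by
  have hsum : ∀ π : V ≃ Fin (Fintype.card V),
      (if inflRank G H v π = 0 then (inflSet G H v π).card else 0) =
        ∑ m ∈ Finset.range (Fintype.card V),
          if inflRank G H v π = 0 ∧ m < (inflSet G H v π).card then 1 else 0 := by
    intro π
    have hle : (inflSet G H v π).card ≤ Fintype.card V := Finset.card_le_univ _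
    by_cases h0 : inflRank G H v π = 0
    · have : (Finset.range (Fintype.card V)).filter (fun m => m < (inflSet G H v π).card) =
          Finset.range (inflSet G H v π).card := by
        ext m
        simp only [Finset.mem_filter, Finset.mem_range]
        omega
      simp [h0, this]
    · simp [h0]
  calc _ = ∑ m ∈ Finset.range (Fintype.card V), (Finset.univ.filter fun π =>
          inflRank G H v π = 0 ∧ m < (inflSet G H v π).card).card := by
        rw [Finset.sum_congr rfl fun π _ => hsum π, Finset.sum_comm]
        simp only [Finset.card_filter]
    _ ≤ ∑ m ∈ Finset.range (Fintype.card V),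
          (Finset.univ.filter fun π => inflRank G H v π = m).card :=
        Finset.sum_le_sum fun m _ => (card_inflRank_zero_le hiso m m le_rfl).trans
          (Finset.card_le_card (Finset.monotone_filter_right _ fun _ _ h => h.1))
    _ ≤ _ := by
        rw [Finset.sum_card_fiberwise_eq_card_filter]
        exact Finset.card_le_univ _

theorem IsIsolation.sum_ncard_symmDiff_le (hiso : IsIsolation G H v) :
    (∑ π : V ≃ Fin (Fintype.card V),
      ({u : V | u ≠ v ∧ ¬ (greedy G (toOrd π) u ↔ greedy H (toOrd π) u)}.ncard : ℝ)) /
        (Fintype.card (V ≃ Fin (Fintype.card V)) : ℝ) ≤ 1 := by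
  refine div_le_one_of_le₀ ?_ (Nat.cast_nonneg _)
  exact_mod_cast (Finset.sum_le_sum fun π _ => hiso.ncard_symmDiff_le π).trans
    (sum_card_inflSet_le hiso)

end Counting

/-- For a single node change (the node `vs` and its incident edges are removed; modeled
on a common vertex type in which `vs` is isolated in the smaller graph, so that the
order induced on the smaller vertex set is the restriction of `π`), the expected number
of vertices other than `vs` whose greedy-MIS membership differs is at most 1. -/
theorem stmt14 {V : Type*} [Fintype V] [DecidableEq V]
    (Gold Gnew : SimpleGraph V) (vs : V)
    (h : (∀ x y, Gnew.Adj x y ↔ Gold.Adj x y ∧ x ≠ vs ∧ y ≠ vs) ∨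
         (∀ x y, Gold.Adj x y ↔ Gnew.Adj x y ∧ x ≠ vs ∧ y ≠ vs)) :
    (∑ π : V ≃ Fin (Fintype.card V),
        (({u : V | u ≠ vs ∧
            ((u ∈ greedySet Gold (toOrd π) ∧ u ∉ greedySet Gnew (toOrd π)) ∨
             (u ∉ greedySet Gold (toOrd π) ∧ u ∈ greedySet Gnew (toOrd π)))}).ncard : ℝ))
      / (Fintype.card (V ≃ Fin (Fintype.card V)) : ℝ) ≤ 1 := by
  rcases h with h | h
  · convert IsIsolation.sum_ncard_symmDiff_le (G := Gold) (H := Gnew) (v := vs) h using 7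
    simp only [greedySet, Set.mem_ofPred_eq]
    tauto
  · convert IsIsolation.sum_ncard_symmDiff_le (G := Gnew) (H := Gold) (v := vs) h using 7
    simp only [greedySet, Set.mem_ofPred_eq]
    tauto

end
end
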